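/- Let n ≤ 5. Any two Schubert problems for S_n, neither of which is dc-equivalent to any dc-trivial Schubert problem, are dc-equivalent to each other (for each n ≤ 5 there is exactly one connected component of the descent-cycling graph containing no dc-trivial vertex). -/

import Mathlib

/- Background definitions: descent-cycling for Schubert problems on S_n,
   with permutations modeled as `Equiv.Perm (Fin n)` (0-indexed positions:
   position i here corresponds to position i+1 in 1-indexed notation). -/

namespace DC

/-- A triple of permutations of {1,…,n}. -/
abbrev Triple (n : ℕ) := Equiv.Perm (Fin n) × Equiv.Perm (Fin n) × Equiv.Perm (Fin n)

/-- The length ℓ(π) = number of inversions of π. -/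
def len {n : ℕ} (π : Equiv.Perm (Fin n)) : ℕ :=
  (Finset.univ.filter (fun p : Fin n × Fin n => p.1 < p.2 ∧ π p.2 < π p.1)).card

/-- π has a descent at (0-indexed) position i, i.e. π(i) > π(i+1). -/
def Descent {n : ℕ} (π : Equiv.Perm (Fin n)) (i : ℕ) : Prop :=
  ∃ h : i + 1 < n, π ⟨i + 1, h⟩ < π ⟨i, Nat.lt_of_succ_lt h⟩

/-- π has an ascent at (0-indexed) position i, i.e. π(i) < π(i+1). -/
def Ascent {n : ℕ} (π : Equiv.Perm (Fin n)) (i : ℕ) : Prop :=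
  ∃ h : i + 1 < n, π ⟨i, Nat.lt_of_succ_lt h⟩ < π ⟨i + 1, h⟩

/-- The adjacent transposition s_i swapping (0-indexed) i and i+1. -/
def s (n i : ℕ) : Equiv.Perm (Fin n) :=
  if h : i + 1 < n then Equiv.swap ⟨i, Nat.lt_of_succ_lt h⟩ ⟨i + 1, h⟩ else 1

/-- The longest permutation w₀ : m ↦ n+1−m (0-indexed: m ↦ n−1−m). -/
def w0 (n : ℕ) : Equiv.Perm (Fin n) := Fin.revPerm

/-- The complement π̄ = w₀ ∘ π of a permutation. -/
def compl {n : ℕ} (π : Equiv.Perm (Fin n)) : Equiv.Perm (Fin n) := w0 n * π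

/-- A Schubert problem: a triple of permutations whose lengths sum to n(n−1)/2. -/
def IsSchubert {n : ℕ} (P : Triple n) : Prop :=
  len P.1 + len P.2.1 + len P.2.2 = n.choose 2

/-- A Schubert problem is dc-trivial if at some position all three permutations ascend. -/
def DCTrivial {n : ℕ} (P : Triple n) : Prop :=
  IsSchubert P ∧ ∃ i : ℕ, Ascent P.1 i ∧ Ascent P.2.1 i ∧ Ascent P.2.2 i

/-- The three Schubert problems obtainable from (u,v,w) by adding a descent at i. -/
def MoveSet {n : ℕ} (u v w : Equiv.Perm (Fin n)) (i : ℕ) : Set (Triple n) :=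
  {(u * s n i, v, w), (u, v * s n i, w), (u, v, w * s n i)}

/-- P and P′ are joined by a single descent-cycling move. -/
def DCMove {n : ℕ} (P P' : Triple n) : Prop :=
  ∃ (u v w : Equiv.Perm (Fin n)) (i : ℕ),
    len u + len v + len w + 1 = n.choose 2 ∧
    Ascent u i ∧ Ascent v i ∧ Ascent w i ∧
    P ∈ MoveSet u v w i ∧ P' ∈ MoveSet u v w i

/-- dc-equivalence: the reflexive–transitive closure of descent-cycling moves. -/
def DCEquiv {n : ℕ} : Triple n → Triple n → Prop := Relation.ReflTransGen DCMove

/-- An admissible functional on triples of permutations: constant on dc-equivalence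
classes of Schubert problems, zero on dc-trivial Schubert problems, one on (id,id,w₀). -/
def Admissible {n : ℕ} (f : Triple n → ℤ) : Prop :=
  (∀ P P' : Triple n, IsSchubert P → IsSchubert P' → DCEquiv P P' → f P = f P') ∧
  (∀ P : Triple n, DCTrivial P → f P = 0) ∧
  f (1, 1, w0 n) = 1

end DC

namespace DC

/-! ### Words: one-line notation as lists of natural numbers -/

/-- The word `l` has a descent at position `i`. -/
def wdesc : List ℕ → ℕ → Bool
  | a :: b :: _, 0 => Nat.ble (b + 1) a
  | _ :: l, i + 1 => wdesc l i
  | _, _ => false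

/-- The word `l` with the letters at positions `i` and `i + 1` swapped. -/
def wswap : List ℕ → ℕ → List ℕ
  | a :: b :: l, 0 => b :: a :: l
  | a :: l, i + 1 => a :: wswap l i
  | l, _ => l

/-- The number of letters smaller than `a`. -/
def below (a : ℕ) : List ℕ → ℕ
  | [] => 0
  | b :: l => cond (Nat.ble (b + 1) a) (below a l + 1) (below a l)

/-- The number of inversions of a word. -/
def winv : List ℕ → ℕ
  | [] => 0
  | a :: l => below a l + winv l

theorem wdesc_iff (l : List ℕ) (i : ℕ) :
    wdesc l i = true ↔ ∃ h : i + 1 < l.length, l[i + 1] < l[i] := by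
  fun_induction wdesc l i with
  | case1 a b l => simp
  | case2 a l i ih => simp [ih]
  | case3 l i h₁ h₂ =>
    match l, i, h₁, h₂ with
    | [], _, _, _ => simp
    | [a], 0, _, _ => simp
    | a :: b :: l, 0, h₁, _ => exact absurd rfl (h₁ a b l rfl)
    | a :: l, i + 1, _, h₂ => exact absurd rfl (h₂ a l i rfl)

theorem getElem?_wswap (l : List ℕ) (i j : ℕ) (h : i + 1 < l.length) :
    (wswap l i)[j]? = if j = i then l[i + 1]? else if j = i + 1 then l[i]? else l[j]? := by
  induction l generalizing i j with
  | nil => simp at h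
  | cons a l ih =>
    cases i with
    | zero =>
      cases l with
      | nil => simp at h
      | cons b l =>
        rcases j with _ | _ | j <;> simp [wswap]
    | succ i =>
      rcases j with _ | j
      · simp [wswap]
      · have h' : i + 1 < l.length := by simpa using h
        simp [wswap, ih i j h']

theorem below_wswap (a : ℕ) (l : List ℕ) (i : ℕ) : below a (wswap l i) = below a l := by
  fun_induction wswap l i with
  | case1 b c l =>
    simp only [below]
    cases Nat.ble (b + 1) a <;> cases Nat.ble (c + 1) a <;> rfl
  | case2 b l i ih => simp only [below, ih]
  | case3 => rfl

theorem winv_wswap (l : List ℕ) (i : ℕ) (h : wdesc l i = true) :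
    winv (wswap l i) + 1 = winv l := by
  fun_induction wdesc l i with
  | case1 a b l =>
    have h' : Nat.ble (a + 1) b = false := by
      have := Nat.le_of_ble_eq_true h
      rw [Bool.eq_false_iff]
      intro h₂
      have := Nat.le_of_ble_eq_true h₂
      omega
    simp only [wswap, winv, below, h, h', cond]
    omega
  | case2 a l i ih =>
    simp only [wswap, winv, below_wswap]
    have := ih h
    omega
  | case3 => simp at h

theorem below_ofFn {n : ℕ} (a : ℕ) (f : Fin n → ℕ) :
    below a (List.ofFn f) = ∑ j, if f j < a then 1 else 0 := by
  induction n with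
  | zero => simp [below]
  | succ n ih =>
    rw [List.ofFn_succ, below, ih, Fin.sum_univ_succ]
    by_cases h : f 0 < a
    · have : Nat.ble (f 0 + 1) a = true := Nat.ble_eq_true_of_le h
      simp only [this, h, if_true, cond]
      exact add_comm _ _
    · have : Nat.ble (f 0 + 1) a = false := by
        rw [Bool.eq_false_iff]
        exact fun h' => h (Nat.le_of_ble_eq_true h')
      simp [this, h]

theorem winv_ofFn {n : ℕ} (f : Fin n → ℕ) :
    winv (List.ofFn f) = ∑ a, ∑ b, if a < b ∧ f b < f a then 1 else 0 := by
  induction n with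
  | zero => simp [winv]
  | succ n ih =>
    rw [List.ofFn_succ, winv, ih, below_ofFn]
    simp only [Fin.sum_univ_succ, Fin.succ_lt_succ_iff, Fin.succ_pos, Fin.not_lt_zero,
      true_and, false_and, if_false, zero_add]

/-- The one-line notation of a permutation. -/
def code {n : ℕ} (π : Equiv.Perm (Fin n)) : List ℕ := List.ofFn fun i => (π i : ℕ)

theorem code_injective {n : ℕ} : Function.Injective (code (n := n)) := fun π σ h => by
  ext i
  exact congrFun (List.ofFn_injective h) i

theorem code_perm_range {n : ℕ} (π : Equiv.Perm (Fin n)) : (code π).Perm (List.range n) := by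
  have h := Equiv.Perm.ofFn_comp_perm π (fun i : Fin n => (i : ℕ))
  have h' : List.ofFn (fun i : Fin n => (i : ℕ)) = List.range n := by
    apply List.ext_getElem <;> simp
  exact h' ▸ h

theorem winv_code {n : ℕ} (π : Equiv.Perm (Fin n)) : winv (code π) = len π := by
  rw [code, winv_ofFn, len, Finset.card_filter, ← Finset.univ_product_univ, Finset.sum_product]
  simp

theorem wdesc_code {n : ℕ} (π : Equiv.Perm (Fin n)) (i : ℕ) :
    wdesc (code π) i = true ↔ Descent π i := by
  rw [wdesc_iff]
  simp [code, Descent]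

theorem code_mul_s {n i : ℕ} (π : Equiv.Perm (Fin n)) (h : i + 1 < n) :
    code (π * s n i) = wswap (code π) i := by
  apply List.ext_getElem?
  intro j
  rw [getElem?_wswap _ _ _ (by simpa [code] using h)]
  by_cases hj : j < n
  · have hi : i < n := by omega
    simp only [code, s, List.getElem?_ofFn, hj, hi, h, dif_pos, Equiv.Perm.mul_apply,
      Equiv.swap_apply_def, Fin.mk.injEq]
    split_ifs <;> rfl
  · have h₁ : j ≠ i := by omega
    have h₂ : j ≠ i + 1 := by omega
    simp [code, hj, h₁, h₂]

/-! ### Descents, ascents and length -/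

theorem ascent_of_not_descent {n i : ℕ} {π : Equiv.Perm (Fin n)} (h : i + 1 < n)
    (hd : ¬ Descent π i) : Ascent π i := by
  refine ⟨h, lt_of_le_of_ne (not_lt.1 fun h' => hd ⟨h, h'⟩) fun h' => ?_⟩
  simpa using π.injective h'

theorem mul_s_mul_s {n : ℕ} (π : Equiv.Perm (Fin n)) (i : ℕ) : π * s n i * s n i = π := by
  unfold s
  split_ifs <;> simp [mul_assoc]

theorem Descent.ascent_mul_s {n i : ℕ} {π : Equiv.Perm (Fin n)} (hd : Descent π i) :
    Ascent (π * s n i) i := by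
  obtain ⟨h, hlt⟩ := hd
  exact ⟨h, by simpa [s, h] using hlt⟩

theorem Ascent.descent_mul_s {n i : ℕ} {π : Equiv.Perm (Fin n)} (ha : Ascent π i) :
    Descent (π * s n i) i := by
  obtain ⟨h, hlt⟩ := ha
  exact ⟨h, by simpa [s, h] using hlt⟩

theorem Descent.len_mul_s {n i : ℕ} {π : Equiv.Perm (Fin n)} (hd : Descent π i) :
    len (π * s n i) + 1 = len π := by
  rw [← winv_code, ← winv_code, code_mul_s π hd.1]
  exact winv_wswap _ _ ((wdesc_code π i).2 hd)

theorem Ascent.len_mul_s {n i : ℕ} {π : Equiv.Perm (Fin n)} (ha : Ascent π i) :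
    len (π * s n i) = len π + 1 := by
  have := ha.descent_mul_s.len_mul_s
  rwa [mul_s_mul_s, eq_comm] at this

/-! ### Symmetries of descent cycling -/

theorem DCMove.swap_left {n : ℕ} {P Q : Triple n} (h : DCMove P Q) :
    DCMove (P.2.1, P.1, P.2.2) (Q.2.1, Q.1, Q.2.2) := by
  obtain ⟨u, v, w, i, hl, hu, hv, hw, hP, hQ⟩ := h
  refine ⟨v, u, w, i, by omega, hv, hu, hw, ?_, ?_⟩
  · rcases hP with rfl | rfl | rfl <;> simp [MoveSet]
  · rcases hQ with rfl | rfl | rfl <;> simp [MoveSet]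

theorem DCMove.swap_right {n : ℕ} {P Q : Triple n} (h : DCMove P Q) :
    DCMove (P.1, P.2.2, P.2.1) (Q.1, Q.2.2, Q.2.1) := by
  obtain ⟨u, v, w, i, hl, hu, hv, hw, hP, hQ⟩ := h
  refine ⟨u, w, v, i, by omega, hu, hw, hv, ?_, ?_⟩
  · rcases hP with rfl | rfl | rfl <;> simp [MoveSet]
  · rcases hQ with rfl | rfl | rfl <;> simp [MoveSet]

theorem DCMove.symm {n : ℕ} {P Q : Triple n} (h : DCMove P Q) : DCMove Q P := by
  obtain ⟨u, v, w, i, hl, hu, hv, hw, hP, hQ⟩ := h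
  exact ⟨u, v, w, i, hl, hu, hv, hw, hQ, hP⟩

theorem DCEquiv.symm {n : ℕ} {P Q : Triple n} (h : DCEquiv P Q) : DCEquiv Q P :=
  have : Std.Symm (DCMove (n := n)) := ⟨fun _ _ => DCMove.symm⟩
  Relation.ReflTransGen.stdSymm.symm _ _ h

/-- A descent at `i` of the first permutation only can be moved to the second one. -/
theorem DCMove.first_second {n i : ℕ} {u v w : Equiv.Perm (Fin n)} (hP : IsSchubert (u, v, w))
    (hu : Descent u i) (hv : Ascent v i) (hw : Ascent w i) :
    DCMove (u, v, w) (u * s n i, v * s n i, w) := by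
  have hl := hu.len_mul_s
  simp only [IsSchubert] at hP
  exact ⟨u * s n i, v, w, i, by omega, hu.ascent_mul_s, hv, hw,
    by simp [MoveSet, mul_s_mul_s], by simp [MoveSet]⟩

theorem IsSchubert.swap_left {n : ℕ} {u v w : Equiv.Perm (Fin n)} (h : IsSchubert (u, v, w)) :
    IsSchubert (v, u, w) := by
  simp only [IsSchubert] at h ⊢
  omega

theorem IsSchubert.swap_right {n : ℕ} {u v w : Equiv.Perm (Fin n)} (h : IsSchubert (u, v, w)) :
    IsSchubert (u, w, v) := by
  simp only [IsSchubert] at h ⊢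
  omega

theorem DCMove.first_third {n i : ℕ} {u v w : Equiv.Perm (Fin n)} (hP : IsSchubert (u, v, w))
    (hu : Descent u i) (hv : Ascent v i) (hw : Ascent w i) :
    DCMove (u, v, w) (u * s n i, v, w * s n i) :=
  (DCMove.first_second hP.swap_right hu hw hv).swap_right

theorem DCMove.second_first {n i : ℕ} {u v w : Equiv.Perm (Fin n)} (hP : IsSchubert (u, v, w))
    (hu : Ascent u i) (hv : Descent v i) (hw : Ascent w i) :
    DCMove (u, v, w) (u * s n i, v * s n i, w) :=
  (DCMove.first_second hP.swap_left hv hu hw).swap_left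

theorem DCMove.second_third {n i : ℕ} {u v w : Equiv.Perm (Fin n)} (hP : IsSchubert (u, v, w))
    (hu : Ascent u i) (hv : Descent v i) (hw : Ascent w i) :
    DCMove (u, v, w) (u, v * s n i, w * s n i) :=
  (DCMove.first_third hP.swap_left hv hu hw).swap_left

theorem DCMove.third_first {n i : ℕ} {u v w : Equiv.Perm (Fin n)} (hP : IsSchubert (u, v, w))
    (hu : Ascent u i) (hv : Ascent v i) (hw : Descent w i) :
    DCMove (u, v, w) (u * s n i, v, w * s n i) :=
  (DCMove.second_first hP.swap_right hu hw hv).swap_right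

theorem DCMove.third_second {n i : ℕ} {u v w : Equiv.Perm (Fin n)} (hP : IsSchubert (u, v, w))
    (hu : Ascent u i) (hv : Ascent v i) (hw : Descent w i) :
    DCMove (u, v, w) (u, v * s n i, w * s n i) :=
  (DCMove.second_third hP.swap_right hu hw hv).swap_right

theorem DCMove.isSchubert {n : ℕ} {P Q : Triple n} (h : DCMove P Q) : IsSchubert Q := by
  obtain ⟨u, v, w, i, hl, hu, hv, hw, -, hQ⟩ := h
  have h₁ := hu.len_mul_s
  have h₂ := hv.len_mul_s
  have h₃ := hw.len_mul_s
  rcases hQ with rfl | rfl | rfl <;> simp only [IsSchubert] <;> omega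

/-! ### Triples of the form `(1, x, w₀ x)` -/

theorem ascent_one {n i : ℕ} (h : i + 1 < n) : Ascent (1 : Equiv.Perm (Fin n)) i :=
  ⟨h, by simp⟩

theorem Descent.ascent_w0_mul {n i : ℕ} {π : Equiv.Perm (Fin n)} (hd : Descent π i) :
    Ascent (w0 n * π) i := by
  obtain ⟨h, hlt⟩ := hd
  exact ⟨h, by simpa [w0] using hlt⟩

theorem eq_one_of_forall_not_descent {n : ℕ} {π : Equiv.Perm (Fin n)}
    (h : ∀ i, ¬ Descent π i) : π = 1 := by
  cases n with
  | zero => exact Subsingleton.elim _ _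
  | succ n =>
    have hmono : StrictMono π := Fin.strictMono_iff_lt_succ.2 fun i =>
      (ascent_of_not_descent (by omega) (h i)).2
    exact Equiv.ext fun i => congrFun hmono.eq_id i

theorem dcEquiv_one_w0_mul {n : ℕ} (x : Equiv.Perm (Fin n)) (h : IsSchubert (1, x, w0 n * x)) :
    DCEquiv (1, x, w0 n * x) (1, 1, w0 n) := by
  induction hk : len x generalizing x with
  | zero =>
    have hx : x = 1 := eq_one_of_forall_not_descent fun i hi => by
      have := hi.len_mul_s
      omega
    subst hx
    exact Relation.ReflTransGen.refl
  | succ k ih =>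
    by_cases hd : ∃ i, Descent x i
    · obtain ⟨i, hi⟩ := hd
      have hm := DCMove.second_third h (ascent_one hi.1) hi hi.ascent_w0_mul
      have hl := hi.len_mul_s
      rw [mul_assoc] at hm
      exact Relation.ReflTransGen.head hm (ih _ hm.isSchubert (by omega))
    · have hx := eq_one_of_forall_not_descent (not_exists.1 hd)
      subst hx
      exact Relation.ReflTransGen.refl

/-! ### The search for triples with a larger sum of squared lengths -/

/-- Some index below `m` satisfies `f`. -/
def anyBelow (f : ℕ → Bool) : ℕ → Bool
  | 0 => false
  | i + 1 => f i || anyBelow f i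

theorem exists_of_anyBelow {f : ℕ → Bool} {m : ℕ} (h : anyBelow f m = true) :
    ∃ i < m, f i = true := by
  induction m with
  | zero => simp [anyBelow] at h
  | succ m ih =>
    rcases Bool.or_eq_true_iff.1 h with h | h
    · exact ⟨m, by omega, h⟩
    · obtain ⟨i, hi, h⟩ := ih h
      exact ⟨i, by omega, h⟩

/-- The three words have a common ascent at some position below `m`. -/
def wtriv (m : ℕ) (u v w : List ℕ) : Bool :=
  anyBelow (fun i => !wdesc u i && (!wdesc v i && !wdesc w i)) m

/-- Starting from three words of lengths `a`, `b`, `c`, at most `k` descent-cycling moves lead to a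
dc-trivial triple or to one whose sum of squared lengths exceeds `p`. -/
def wsearch (m p : ℕ) : ℕ → ℕ → ℕ → ℕ → List ℕ → List ℕ → List ℕ → Bool
  | 0, a, b, c, u, v, w => wtriv m u v w || Nat.ble (p + 1) (a ^ 2 + b ^ 2 + c ^ 2)
  | k + 1, a, b, c, u, v, w => (wtriv m u v w || Nat.ble (p + 1) (a ^ 2 + b ^ 2 + c ^ 2)) ||
      anyBelow (fun i => match wdesc u i, wdesc v i, wdesc w i with
        | true, false, false =>
          wsearch m p k (a - 1) b (c + 1) (wswap u i) v (wswap w i) ||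
          wsearch m p k (a - 1) (b + 1) c (wswap u i) (wswap v i) w
        | false, true, false =>
          wsearch m p k a (b - 1) (c + 1) u (wswap v i) (wswap w i) ||
          wsearch m p k (a + 1) (b - 1) c (wswap u i) (wswap v i) w
        | false, false, true =>
          wsearch m p k a (b + 1) (c - 1) u (wswap v i) (wswap w i) ||
          wsearch m p k (a + 1) b (c - 1) (wswap u i) v (wswap w i)
        | _, _, _ => false) m

/-- The words of the permutations of length `k`. -/
def wordsOf (n k : ℕ) : List (List ℕ) :=
  (List.range n).permutations'.filter fun l => winv l == k

/-- Every Schubert problem of lengths `a ≤ b ≤ c` other than `(1, 1, w₀)` is at most four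
descent-cycling moves away from a dc-trivial one or one with a larger sum of squared lengths. -/
def check (n : ℕ) : Bool :=
  (List.range (n.choose 2 + 1)).all fun a => (List.range (n.choose 2 + 1)).all fun b =>
    !(Nat.ble a b && Nat.ble (a + 2 * b) (n.choose 2)) ||
    (wordsOf n a).all fun u => (wordsOf n b).all fun v =>
      (wordsOf n (n.choose 2 - a - b)).all fun w =>
        anyBelow (fun k => wsearch (n - 1) (a ^ 2 + b ^ 2 + (n.choose 2 - a - b) ^ 2) (4 - k)
          a b (n.choose 2 - a - b) u v w) 4 ||
        (u == List.range n && (v == List.range n && w == (List.range n).reverse))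

/-- The sum of the squared lengths. -/
def sqLen {n : ℕ} (P : Triple n) : ℕ := len P.1 ^ 2 + len P.2.1 ^ 2 + len P.2.2 ^ 2

theorem dcTrivial_of_wtriv {n : ℕ} {u v w : Equiv.Perm (Fin n)} (hP : IsSchubert (u, v, w))
    (h : wtriv (n - 1) (code u) (code v) (code w) = true) : DCTrivial (u, v, w) := by
  obtain ⟨i, hi, h⟩ := exists_of_anyBelow h
  simp only [Bool.and_eq_true, Bool.not_eq_true', ← Bool.not_eq_true, wdesc_code] at h
  exact ⟨hP, i, ascent_of_not_descent (by omega) h.1, ascent_of_not_descent (by omega) h.2.1,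
    ascent_of_not_descent (by omega) h.2.2⟩

theorem exists_of_wsearch {n p k : ℕ} {u v w : Equiv.Perm (Fin n)} (hP : IsSchubert (u, v, w))
    (h : wsearch (n - 1) p k (len u) (len v) (len w) (code u) (code v) (code w) = true) :
    ∃ R : Triple n, IsSchubert R ∧ DCEquiv (u, v, w) R ∧ (DCTrivial R ∨ p < sqLen R) := by
  induction k generalizing u v w with
  | zero =>
    rcases Bool.or_eq_true_iff.1 h with h | h
    · exact ⟨_, hP, Relation.ReflTransGen.refl, Or.inl (dcTrivial_of_wtriv hP h)⟩
    · exact ⟨_, hP, Relation.ReflTransGen.refl, Or.inr (Nat.le_of_ble_eq_true h)⟩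
  | succ k ih =>
    have step : ∀ u' v' w' : Equiv.Perm (Fin n), DCMove (u, v, w) (u', v', w') →
        wsearch (n - 1) p k (len u') (len v') (len w') (code u') (code v') (code w') = true →
        ∃ R : Triple n, IsSchubert R ∧ DCEquiv (u, v, w) R ∧ (DCTrivial R ∨ p < sqLen R) := by
      intro u' v' w' hm h
      obtain ⟨R, hR, he, h⟩ := ih hm.isSchubert h
      exact ⟨R, hR, Relation.ReflTransGen.head hm he, h⟩
    rw [wsearch, Bool.or_eq_true, Bool.or_eq_true] at h
    rcases h with (h | h) | h
    · exact ⟨_, hP, Relation.ReflTransGen.refl, Or.inl (dcTrivial_of_wtriv hP h)⟩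
    · exact ⟨_, hP, Relation.ReflTransGen.refl, Or.inr (Nat.le_of_ble_eq_true h)⟩
    obtain ⟨i, hi, h⟩ := exists_of_anyBelow h
    have hi' : i + 1 < n := by omega
    have desc : ∀ {x : Equiv.Perm (Fin n)}, wdesc (code x) i = true → Descent x i ∧
        len (x * s n i) = len x - 1 := fun {x} hx => by
      have hd := (wdesc_code x i).1 hx
      have := hd.len_mul_s
      exact ⟨hd, by omega⟩
    have asc : ∀ {x : Equiv.Perm (Fin n)}, wdesc (code x) i = false → Ascent x i ∧
        len (x * s n i) = len x + 1 := fun {x} hx => by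
      have ha := ascent_of_not_descent hi' (mt (wdesc_code x i).2 (by simp [hx]))
      exact ⟨ha, ha.len_mul_s⟩
    simp only [← code_mul_s _ hi'] at h
    split at h
    · rename_i hu hv hw
      obtain ⟨hu, hu'⟩ := desc hu
      obtain ⟨hv, hv'⟩ := asc hv
      obtain ⟨hw, hw'⟩ := asc hw
      rw [← hu', ← hv', ← hw', Bool.or_eq_true] at h
      rcases h with h | h
      · exact step _ _ _ (DCMove.first_third hP hu hv hw) h
      · exact step _ _ _ (DCMove.first_second hP hu hv hw) h
    · rename_i hu hv hw
      obtain ⟨hu, hu'⟩ := asc hu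
      obtain ⟨hv, hv'⟩ := desc hv
      obtain ⟨hw, hw'⟩ := asc hw
      rw [← hu', ← hv', ← hw', Bool.or_eq_true] at h
      rcases h with h | h
      · exact step _ _ _ (DCMove.second_third hP hu hv hw) h
      · exact step _ _ _ (DCMove.second_first hP hu hv hw) h
    · rename_i hu hv hw
      obtain ⟨hu, hu'⟩ := asc hu
      obtain ⟨hv, hv'⟩ := asc hv
      obtain ⟨hw, hw'⟩ := desc hw
      rw [← hu', ← hv', ← hw', Bool.or_eq_true] at h
      rcases h with h | h
      · exact step _ _ _ (DCMove.third_second hP hu hv hw) h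
      · exact step _ _ _ (DCMove.third_first hP hu hv hw) h
    · simp at h

theorem code_mem_wordsOf {n : ℕ} (π : Equiv.Perm (Fin n)) : code π ∈ wordsOf n (len π) := by
  simp [wordsOf, List.mem_permutations', code_perm_range, winv_code]

theorem code_one (n : ℕ) : code (1 : Equiv.Perm (Fin n)) = List.range n := by
  apply List.ext_getElem <;> simp [code]

theorem code_w0 (n : ℕ) : code (w0 n) = (List.range n).reverse := by
  apply List.ext_getElem
  · simp [code]
  · intro i h₁ h₂
    simp [code, w0, Fin.val_rev]
    omega

theorem exists_of_check {n : ℕ} (hn : check n = true) {u v w : Equiv.Perm (Fin n)}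
    (hP : IsSchubert (u, v, w)) (huv : len u ≤ len v) (hvw : len v ≤ len w) :
    (u, v, w) = ((1, 1, w0 n) : Triple n) ∨ ∃ R : Triple n, IsSchubert R ∧ DCEquiv (u, v, w) R ∧
      (DCTrivial R ∨ sqLen (u, v, w) < sqLen R) := by
  have hl : len u + len v + len w = n.choose 2 := hP
  have hw : n.choose 2 - len u - len v = len w := by omega
  have h := List.all_eq_true.1 hn (len u) (List.mem_range.2 (by omega))
  have h := List.all_eq_true.1 h (len v) (List.mem_range.2 (by omega))
  rw [Nat.ble_eq_true_of_le huv, Nat.ble_eq_true_of_le (show len u + 2 * len v ≤ n.choose 2 by omega),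
    hw] at h
  have h := List.all_eq_true.1 h (code u) (code_mem_wordsOf u)
  have h := List.all_eq_true.1 h (code v) (code_mem_wordsOf v)
  have h := List.all_eq_true.1 h (code w) (code_mem_wordsOf w)
  rcases Bool.or_eq_true_iff.1 h with h | h
  · obtain ⟨k, -, h⟩ := exists_of_anyBelow h
    exact Or.inr (exists_of_wsearch hP h)
  · simp only [Bool.and_eq_true, beq_iff_eq] at h
    rw [← code_w0, ← code_one, code_injective.eq_iff, code_injective.eq_iff,
      code_injective.eq_iff] at h
    obtain ⟨rfl, rfl, rfl⟩ := h
    exact Or.inl rfl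

/-! ### Every Schubert problem is equivalent to a dc-trivial one or to `(1, 1, w₀)` -/

/-- `P` is dc-equivalent to a dc-trivial Schubert problem or to `(1, 1, w₀)`. -/
def Solved {n : ℕ} (P : Triple n) : Prop :=
  ∃ R : Triple n, DCEquiv P R ∧ (DCTrivial R ∨ R = (1, 1, w0 n))

theorem Solved.swap_left {n : ℕ} {u v w : Equiv.Perm (Fin n)} (h : Solved (u, v, w)) :
    Solved (v, u, w) := by
  obtain ⟨R, he, h⟩ := h
  refine ⟨(R.2.1, R.1, R.2.2), Relation.ReflTransGen.lift
    (fun P : Triple n => ((P.2.1, P.1, P.2.2) : Triple n)) (fun _ _ => DCMove.swap_left) _ _ he, ?_⟩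
  rcases h with ⟨hR, i, hu, hv, hw⟩ | rfl
  · exact Or.inl ⟨IsSchubert.swap_left hR, i, hv, hu, hw⟩
  · exact Or.inr rfl

theorem DCEquiv.isSchubert {n : ℕ} {P Q : Triple n} (h : DCEquiv P Q) (hP : IsSchubert P) :
    IsSchubert Q := by
  induction h with
  | refl => exact hP
  | tail _ hm _ => exact hm.isSchubert

theorem Solved.swap_right {n : ℕ} {u v w : Equiv.Perm (Fin n)} (hP : IsSchubert (u, v, w))
    (h : Solved (u, v, w)) : Solved (u, w, v) := by
  obtain ⟨R, he, h⟩ := h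
  have he' : DCEquiv (u, w, v) (R.1, R.2.2, R.2.1) := Relation.ReflTransGen.lift
    (fun P : Triple n => ((P.1, P.2.2, P.2.1) : Triple n)) (fun _ _ => DCMove.swap_right) _ _ he
  rcases h with ⟨hR, i, hu, hv, hw⟩ | rfl
  · exact ⟨_, he', Or.inl ⟨IsSchubert.swap_right hR, i, hu, hw, hv⟩⟩
  · have hw0 : w0 n * w0 n = 1 := by
      ext i
      simp [w0]
    have h := dcEquiv_one_w0_mul (w0 n)
    rw [hw0] at h
    exact ⟨_, he'.trans (h (he.isSchubert hP).swap_right), Or.inr rfl⟩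

theorem IsSchubert.sqLen_le {n : ℕ} {P : Triple n} (hP : IsSchubert P) :
    sqLen P ≤ n.choose 2 ^ 2 := by
  simp only [IsSchubert] at hP
  rw [sqLen, ← hP]
  nlinarith [Nat.zero_le (len P.1 * len P.2.1), Nat.zero_le (len P.1 * len P.2.2),
    Nat.zero_le (len P.2.1 * len P.2.2)]

theorem solved_of_check {n : ℕ} (hn : check n = true) (P : Triple n) (hP : IsSchubert P) :
    Solved P := by
  induction hk : n.choose 2 ^ 2 - sqLen P using Nat.strong_induction_on generalizing P with
  | _ k ih =>
    have sorted : ∀ u v w : Equiv.Perm (Fin n), IsSchubert (u, v, w) → len u ≤ len v →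
        len v ≤ len w → sqLen (u, v, w) = sqLen P → Solved (u, v, w) := by
      intro u v w h huv hvw hs
      rcases exists_of_check hn h huv hvw with he | ⟨R, hR, he, ht | hlt⟩
      · exact ⟨_, Relation.ReflTransGen.refl, Or.inr he⟩
      · exact ⟨R, he, Or.inl ht⟩
      · have := hR.sqLen_le
        obtain ⟨R', he', h'⟩ := ih _ (by omega) R hR rfl
        exact ⟨R', he.trans he', h'⟩
    obtain ⟨u, v, w⟩ := P
    have h₁ := hP.swap_left
    have h₂ := hP.swap_right
    rcases le_total (len u) (len v) with huv | huv <;>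
      rcases le_total (len v) (len w) with hvw | hvw <;>
      rcases le_total (len u) (len w) with huw | huw
    · exact sorted _ _ _ hP huv hvw rfl
    · exact sorted _ _ _ hP huv hvw rfl
    · exact (sorted _ _ _ h₂ huw hvw (by simp only [sqLen]; ring)).swap_right h₂
    · exact ((sorted _ _ _ h₂.swap_left huw huv (by simp only [sqLen]; ring)).swap_left).swap_right
        h₂
    · exact (sorted _ _ _ h₁ huv huw (by simp only [sqLen]; ring)).swap_left
    · exact ((sorted _ _ _ h₁.swap_right hvw huw
        (by simp only [sqLen]; ring)).swap_right h₁.swap_right).swap_left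
    · exact (((sorted _ _ _ h₁.swap_right.swap_left hvw huv
        (by simp only [sqLen]; ring)).swap_left).swap_right h₁.swap_right).swap_left
    · exact (((sorted _ _ _ h₁.swap_right.swap_left hvw huv
        (by simp only [sqLen]; ring)).swap_left).swap_right h₁.swap_right).swap_left

theorem check_five : check 5 = true := by decide +kernel

theorem check_of_le_five {n : ℕ} (hn : n ≤ 5) : check n = true := by
  rcases Nat.lt_or_eq_of_le hn with h | rfl
  · interval_cases n <;> decide +kernel
  · exact check_five

end DC

/-- For n ≤ 5, any two Schubert problems for S_n, neither of which is dc-equivalent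
to any dc-trivial Schubert problem, are dc-equivalent to each other. -/
theorem statement11 {n : ℕ} (hn : n ≤ 5) (P Q : DC.Triple n)
    (hP : DC.IsSchubert P) (hQ : DC.IsSchubert Q)
    (hP' : ¬ ∃ R : DC.Triple n, DC.DCTrivial R ∧ DC.DCEquiv P R)
    (hQ' : ¬ ∃ R : DC.Triple n, DC.DCTrivial R ∧ DC.DCEquiv Q R) :
    DC.DCEquiv P Q := by
  obtain ⟨R, hR, ht | rfl⟩ := DC.solved_of_check (DC.check_of_le_five hn) P hP
  · exact absurd ⟨R, ht, hR⟩ hP'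
  obtain ⟨S, hS, ht | rfl⟩ := DC.solved_of_check (DC.check_of_le_five hn) Q hQ
  · exact absurd ⟨S, ht, hS⟩ hQ'
  exact hR.trans hS.symm
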